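/- Let α ∈ (0,2), let φ satisfy π/2 < φ < π and αφ < π, let r > 0 and ξ > 0 with r^α < ξ. Then for every t > 0, (1/(2πi)) ∫_{Γ(φ,r)} e^{λ t} / (λ^α − ξ) dλ = (1/π) ∫₀^∞ e^{−tτ} τ^α sin(απ) / ( τ^{2α} − 2 ξ cos(απ) τ^α + ξ² ) dτ. -/

import Mathlib

open MeasureTheory Set Real

/-- The integral of `G` over the contour `Γ(φ,R)`. -/
noncomputable def contourIntegral {X : Type*} [NormedAddCommGroup X] [NormedSpace ℂ X]
    (φ R : ℝ) (G : ℂ → X) : X :=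
  (∫ τ in Ioi R,
      (Complex.exp (Complex.I * φ) • G ((τ : ℂ) * Complex.exp (Complex.I * φ))
        - Complex.exp (-(Complex.I * φ)) • G ((τ : ℂ) * Complex.exp (-(Complex.I * φ)))))
  + ∫ ψ in (-φ)..φ,
      (Complex.I * R * Complex.exp (Complex.I * ψ)) • G ((R : ℂ) * Complex.exp (Complex.I * ψ))

/-- integrand in logarithmic coordinates -/
noncomputable def FF (α ξ t : ℝ) (w : ℂ) : ℂ :=
  Complex.exp w * (Complex.exp (Complex.exp w * t) / (Complex.exp (w * α) - ξ))

/-- integrand along the ray of angle `θ` -/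
noncomputable def gg (α ξ t θ : ℝ) (τ : ℝ) : ℂ :=
  Complex.exp (Complex.I * θ) * (Complex.exp ((τ : ℂ) * Complex.exp (Complex.I * θ) * t) /
    (((τ ^ α : ℝ) : ℂ) * Complex.exp (Complex.I * θ * α) - ξ))

lemma nonvanish {α ξ : ℝ} (hα : α ∈ Ioo (0:ℝ) 2) (hξ : 0 < ξ) {θ : ℝ} (h0 : θ ≠ 0)
    (h1 : |θ| ≤ π) {s : ℝ} (hs : 0 ≤ s) :
    (s : ℂ) * Complex.exp (Complex.I * θ * α) - ξ ≠ 0 := by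
  intro h
  have h2 : (s : ℂ) * Complex.exp (Complex.I * θ * α) = ξ := sub_eq_zero.mp h
  have h3 : s = ξ := by
    have := congrArg norm h2
    rw [norm_mul, show Complex.I * θ * α = ((θ * α : ℝ) : ℂ) * Complex.I by push_cast; ring,
      Complex.norm_exp_ofReal_mul_I, Complex.norm_real, Complex.norm_real] at this
    simpa [abs_of_nonneg hs, abs_of_pos hξ] using this
  subst h3
  have h4 : Complex.exp (Complex.I * θ * α) = 1 := by
    have : (s : ℂ) ≠ 0 := by exact_mod_cast hξ.ne'
    exact mul_left_cancel₀ this (by rw [h2, mul_one])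
  obtain ⟨n, hn⟩ := Complex.exp_eq_one_iff.mp h4
  have h5 : θ * α = n * (2 * π) := by
    have := congrArg Complex.im hn
    simpa using this
  have hpi := Real.pi_pos
  have h6 : |θ * α| < 2 * π := by
    rw [abs_mul, abs_of_pos hα.1]
    have : 0 < |θ| := abs_pos.mpr h0
    nlinarith [hα.1, hα.2]
  rw [h5, abs_mul, abs_of_pos (by positivity : (0:ℝ) < 2 * π)] at h6
  have h7 : |(n : ℝ)| < 1 := by
    by_contra hc
    push Not at hc
    nlinarith
  have h8 : n = 0 := by
    have : |n| < 1 := by exact_mod_cast h7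
    exact Int.abs_lt_one_iff.mp this
  rw [h8] at h5
  have : α ≠ 0 := hα.1.ne'
  simp_all

lemma FF_eq_gg (α ξ t θ x : ℝ) :
    FF α ξ t (x + θ * Complex.I) = (Real.exp x : ℂ) * gg α ξ t θ (Real.exp x) := by
  unfold FF gg
  have h1 : Complex.exp (x + θ * Complex.I) = (Real.exp x : ℂ) * Complex.exp (Complex.I * θ) := by
    rw [Complex.exp_add, Complex.ofReal_exp, mul_comm Complex.I]
  have h2 : Complex.exp ((x + θ * Complex.I) * α)
      = (((Real.exp x) ^ α : ℝ) : ℂ) * Complex.exp (Complex.I * θ * α) := by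
    rw [← Real.exp_mul, Complex.ofReal_exp, ← Complex.exp_add]
    congr 1; push_cast; ring
  rw [h1, h2]; ring

lemma gg_cont {α ξ : ℝ} (t : ℝ) (hα : α ∈ Ioo (0:ℝ) 2) (hξ : 0 < ξ) {θ : ℝ} (h0 : θ ≠ 0)
    (h1 : |θ| ≤ π) : ContinuousOn (gg α ξ t θ) (Ici 0) := by
  unfold gg
  have hp : Continuous (fun τ : ℝ => τ ^ α) := Real.continuous_rpow_const hα.1.le
  refine ContinuousOn.mul continuousOn_const (ContinuousOn.div ?_ ?_ ?_)
  · fun_prop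
  · have : Continuous (fun τ : ℝ => ((τ ^ α : ℝ) : ℂ)) := Complex.continuous_ofReal.comp hp
    fun_prop
  · intro τ hτ
    exact nonvanish hα hξ h0 h1 (Real.rpow_nonneg hτ α)

/-- norm bound for large radius -/
lemma gg_bound {α ξ t θ τ : ℝ} (hξ : 0 < ξ) (h : ξ + 1 ≤ τ ^ α) :
    ‖gg α ξ t θ τ‖ ≤ Real.exp (t * Real.cos θ * τ) := by
  unfold gg
  have e1 : ‖Complex.exp (Complex.I * θ)‖ = 1 := by
    rw [mul_comm, Complex.norm_exp_ofReal_mul_I]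
  have e2 : ‖Complex.exp (Complex.I * θ * α)‖ = 1 := by
    rw [show Complex.I * θ * α = ((θ * α : ℝ) : ℂ) * Complex.I by push_cast; ring,
      Complex.norm_exp_ofReal_mul_I]
  have e3 : 1 ≤ ‖((τ ^ α : ℝ) : ℂ) * Complex.exp (Complex.I * θ * α) - ξ‖ := by
    have := norm_sub_norm_le (((τ ^ α : ℝ) : ℂ) * Complex.exp (Complex.I * θ * α)) (ξ : ℂ)
    rw [norm_mul, e2, Complex.norm_real, Complex.norm_real, Real.norm_of_nonneg hξ.le,
      Real.norm_of_nonneg (by linarith : 0 ≤ τ ^ α)] at this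
    linarith
  rw [norm_mul, e1, one_mul, norm_div]
  refine (div_le_self (norm_nonneg _) e3).trans ?_
  rw [Complex.norm_exp]
  apply le_of_eq
  congr 1
  rw [mul_comm Complex.I, Complex.exp_mul_I, ← Complex.ofReal_cos, ← Complex.ofReal_sin]
  simp [-Complex.ofReal_cos, -Complex.ofReal_sin]
  ring

lemma gg_integrable {α ξ t : ℝ} (ht : 0 < t) (hα : α ∈ Ioo (0:ℝ) 2) (hξ : 0 < ξ) {θ : ℝ}
    (hc : Real.cos θ < 0) (h1 : |θ| ≤ π) : IntegrableOn (gg α ξ t θ) (Ioi 0) := by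
  have h0 : θ ≠ 0 := by
    rintro rfl
    simp at hc
    linarith
  have hb : 0 < -(t * Real.cos θ) := by nlinarith
  refine integrableOn_Ici_iff_integrableOn_Ioi (by finiteness) |>.mp <|
    ((gg_cont t hα hξ h0 h1).locallyIntegrableOn measurableSet_Ici).integrableOn_of_isBigO_atTop
    (g := fun x => Real.exp (-(-(t * Real.cos θ)) * x)) ?_
    ⟨Ioi 0, Filter.Ioi_mem_atTop 0, exp_neg_integrableOn_Ioi 0 hb⟩
  refine Asymptotics.IsBigO.of_bound 1 ?_
  have h2 := (tendsto_rpow_atTop hα.1).eventually_ge_atTop (ξ + 1)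
  filter_upwards [h2] with τ h3
  rw [one_mul, Real.norm_of_nonneg (Real.exp_nonneg _), neg_neg]
  exact gg_bound hξ h3

lemma FF_integral {α ξ : ℝ} (t : ℝ) (hα : α ∈ Ioo (0:ℝ) 2) (hξ : 0 < ξ) {θ : ℝ} (h0 : θ ≠ 0)
    (h1 : |θ| ≤ π) (a b : ℝ) :
    ∫ x in a..b, FF α ξ t (x + θ * Complex.I) = ∫ τ in (Real.exp a)..(Real.exp b), gg α ξ t θ τ := by
  have := intervalIntegral.integral_deriv_smul_comp''' (a := a) (b := b) (f := Real.exp)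
    (f' := Real.exp) (g := gg α ξ t θ) Real.continuous_exp.continuousOn
    (fun x _ => (Real.hasDerivAt_exp x).hasDerivWithinAt)
    ((gg_cont t hα hξ h0 h1).mono (by
      rintro _ ⟨x, _, rfl⟩; exact (Real.exp_pos x).le)) ?_ ?_
  · rw [← this]
    apply intervalIntegral.integral_congr
    intro x _
    simp only [FF_eq_gg, Function.comp, Complex.real_smul]
  · apply (ContinuousOn.integrableOn_compact (isCompact_uIcc.image Real.continuous_exp))
    exact ((gg_cont t hα hξ h0 h1).mono (by
      rintro _ ⟨x, _, rfl⟩; exact (Real.exp_pos x).le))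
  · apply (ContinuousOn.integrableOn_compact isCompact_uIcc)
    have hc : ContinuousOn (fun x => Real.exp x) (uIcc a b) := Real.continuous_exp.continuousOn
    simp only [Complex.real_smul]
    refine ContinuousOn.mul (Complex.continuous_ofReal.comp_continuousOn hc) ?_
    refine (gg_cont t hα hξ h0 h1).comp Real.continuous_exp.continuousOn ?_
    intro x _; exact (Real.exp_pos x).le

lemma FF_diff {α ξ t : ℝ} {w : ℂ} (h : Complex.exp (w * α) - ξ ≠ 0) :
    DifferentiableAt ℂ (FF α ξ t) w := by
  unfold FF
  fun_prop (disch := assumption)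

lemma exp_split (α : ℝ) (w : ℂ) : Complex.exp (w * α)
    = ((Real.exp (w.re * α) : ℝ) : ℂ) * Complex.exp (Complex.I * (w.im : ℂ) * α) := by
  rw [Complex.ofReal_exp, ← Complex.exp_add]
  congr 1
  conv_lhs => rw [← Complex.re_add_im w]
  push_cast; ring

lemma FF_diff1 {α ξ t : ℝ} (hα : α ∈ Ioo (0:ℝ) 2) (hξ : 0 < ξ) {w : ℂ} (h0 : w.im ≠ 0)
    (h1 : |w.im| ≤ π) : DifferentiableAt ℂ (FF α ξ t) w := by
  apply FF_diff
  rw [exp_split]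
  exact nonvanish hα hξ h0 h1 (Real.exp_nonneg _)

lemma FF_den2 {α ξ : ℝ} (hξ : 0 < ξ) (w : ℂ) :
    ξ - Real.exp (w.re * α) ≤ ‖Complex.exp (w * α) - ξ‖ := by
  have := norm_sub_norm_le (ξ : ℂ) (Complex.exp (w * α))
  rw [norm_sub_rev, Complex.norm_exp, Complex.norm_real, Real.norm_of_nonneg hξ.le] at this
  simpa using this

lemma FF_diff2 {α ξ t : ℝ} (hξ : 0 < ξ) {w : ℂ} (h : Real.exp (w.re * α) < ξ) :
    DifferentiableAt ℂ (FF α ξ t) w := by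
  apply FF_diff
  rw [← norm_pos_iff]
  linarith [FF_den2 (α := α) hξ w]

lemma FF_bound_left {α ξ t : ℝ} (ht : 0 < t) (hξ : 0 < ξ) {x : ℝ} (θ : ℝ) (hx : x ≤ 0)
    (h : Real.exp (x * α) ≤ ξ / 2) :
    ‖FF α ξ t (x + θ * Complex.I)‖ ≤ Real.exp x * (Real.exp t / (ξ / 2)) := by
  unfold FF
  have e1 : ‖Complex.exp (x + θ * Complex.I)‖ = Real.exp x := by
    rw [Complex.norm_exp]; simp
  have e2 := FF_den2 (α := α) hξ (x + θ * Complex.I)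
  have e3 : ((x : ℂ) + θ * Complex.I).re = x := by simp
  rw [e3] at e2
  rw [norm_mul, norm_div, e1]
  gcongr
  · rw [Complex.norm_exp]
    apply Real.exp_le_exp.mpr
    refine (Complex.re_le_norm _).trans ?_
    rw [norm_mul, e1, Complex.norm_real, Real.norm_of_nonneg ht.le]
    have : Real.exp x ≤ 1 := Real.exp_le_one_iff.mpr hx
    nlinarith
  · linarith

lemma rect {f : ℂ → ℂ} {a b c d : ℝ} (hab : a ≤ b) (hcd : c ≤ d)
    (H : ∀ w : ℂ, a ≤ w.re → w.re ≤ b → c ≤ w.im → w.im ≤ d → DifferentiableAt ℂ f w) :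
    (∫ x in a..b, f (x + c * Complex.I)) - (∫ x in a..b, f (x + d * Complex.I))
      + Complex.I * (∫ y in c..d, f (b + y * Complex.I))
      - Complex.I * (∫ y in c..d, f (a + y * Complex.I)) = 0 := by
  have := Complex.integral_boundary_rect_eq_zero_of_differentiableOn f ⟨a, c⟩ ⟨b, d⟩ ?_
  · simpa using this
  · intro w hw
    simp only [uIcc_of_le hab, uIcc_of_le hcd, Complex.mem_reProdIm, mem_Icc] at hw
    exact (H w hw.1.1 hw.1.2 hw.2.1 hw.2.2).differentiableWithinAt

lemma gg_ii {α ξ : ℝ} (t : ℝ) (hα : α ∈ Ioo (0:ℝ) 2) (hξ : 0 < ξ) {θ : ℝ} (h0 : θ ≠ 0)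
    (h1 : |θ| ≤ π) {a b : ℝ} (ha : 0 ≤ a) (hb : 0 ≤ b) :
    IntervalIntegrable (gg α ξ t θ) volume a b := by
  apply ContinuousOn.intervalIntegrable
  apply (gg_cont t hα hξ h0 h1).mono
  intro x hx
  exact (le_min ha hb).trans hx.1

lemma key {α ξ φ r t : ℝ} (hα : α ∈ Ioo (0:ℝ) 2) (hφ₁ : π / 2 < φ) (hφ₂ : φ < π)
    (hr : 0 < r) (hξ : 0 < ξ) (hrξ : r ^ α < ξ) {X Y : ℝ} (hX : Real.log r ≤ X)
    (hY : Y ≤ Real.log r) :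
    (∫ τ in r..(Real.exp X), gg α ξ t φ τ) - (∫ τ in r..(Real.exp X), gg α ξ t (-φ) τ)
      + Complex.I * (∫ y in (-φ)..φ, FF α ξ t (Real.log r + y * Complex.I))
    = (∫ τ in (Real.exp Y)..(Real.exp X), gg α ξ t π τ)
      - (∫ τ in (Real.exp Y)..(Real.exp X), gg α ξ t (-π) τ)
      + Complex.I * (∫ y in (-π)..π, FF α ξ t (Y + y * Complex.I))
      - Complex.I * (∫ y in φ..π, FF α ξ t (X + y * Complex.I))
      - Complex.I * (∫ y in (-π)..(-φ), FF α ξ t (X + y * Complex.I)) := by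
  have hpi := Real.pi_pos
  have hlt : ∀ x : ℝ, x ≤ Real.log r → Real.exp (x * α) < ξ := by
    intro x hx
    refine lt_of_le_of_lt ?_ hrξ
    rw [Real.rpow_def_of_pos hr]
    exact Real.exp_le_exp.mpr (mul_le_mul_of_nonneg_right hx hα.1.le)
  have R1 := rect (f := FF α ξ t) hX hφ₂.le (fun w _ _ h3 h4 =>
    FF_diff1 hα hξ (by intro h; linarith) (abs_le.mpr ⟨by linarith, h4⟩))
  have R2 := rect (f := FF α ξ t) (c := -π) (d := -φ) hX (by linarith) (fun w _ _ h3 h4 =>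
    FF_diff1 hα hξ (by intro h; linarith) (abs_le.mpr ⟨h3, by linarith⟩))
  have R3 := rect (f := FF α ξ t) (c := -π) (d := π) hY (by linarith) (fun w _ h2 _ _ =>
    FF_diff2 hξ (hlt _ h2))
  have p1 : φ ≠ 0 := by intro h; linarith
  have p2 : -φ ≠ 0 := by intro h; linarith
  have p3 : π ≠ 0 := hpi.ne'
  have p4 : -π ≠ 0 := by intro h; linarith
  have q1 : |φ| ≤ π := abs_le.mpr ⟨by linarith, by linarith⟩
  have q2 : |-φ| ≤ π := abs_le.mpr ⟨by linarith, by linarith⟩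
  have q3 : |π| ≤ π := abs_le.mpr ⟨by linarith, by linarith⟩
  have q4 : |-π| ≤ π := abs_le.mpr ⟨by linarith, by linarith⟩
  rw [FF_integral t hα hξ p1 q1, FF_integral t hα hξ p3 q3, Real.exp_log hr] at R1
  rw [FF_integral t hα hξ p2 q2, FF_integral t hα hξ p4 q4, Real.exp_log hr] at R2
  rw [FF_integral t hα hξ p3 q3, FF_integral t hα hξ p4 q4, Real.exp_log hr] at R3
  have s1 := intervalIntegral.integral_add_adjacent_intervals
    (gg_ii t hα hξ p3 q3 (Real.exp_pos Y).le hr.le) (gg_ii t hα hξ p3 q3 hr.le (Real.exp_pos X).le)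
  have s2 := intervalIntegral.integral_add_adjacent_intervals
    (gg_ii t hα hξ p4 q4 (Real.exp_pos Y).le hr.le) (gg_ii t hα hξ p4 q4 hr.le (Real.exp_pos X).le)
  have hc : Continuous (fun y : ℝ => FF α ξ t (Real.log r + y * Complex.I)) := by
    rw [continuous_iff_continuousAt]
    intro y
    have : ContinuousAt (FF α ξ t) (Real.log r + y * Complex.I) :=
      (FF_diff2 hξ (hlt _ (by simp))).continuousAt
    exact ContinuousAt.comp (f := fun y : ℝ => (Real.log r + y * Complex.I : ℂ)) this (by fun_prop)
  have s3 := intervalIntegral.integral_add_adjacent_intervals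
    (hc.intervalIntegrable (μ := volume) (-π) (-φ)) (hc.intervalIntegrable (-φ) φ)
  have s4 := intervalIntegral.integral_add_adjacent_intervals
    (hc.intervalIntegrable (μ := volume) (-π) φ) (hc.intervalIntegrable φ π)
  rw [← s4, ← s3] at R3
  rw [← s1, ← s2]
  linear_combination R1 + R2 + R3

lemma lim_left {α ξ t : ℝ} (hα : α ∈ Ioo (0:ℝ) 2) (hξ : 0 < ξ) (ht : 0 < t) :
    Filter.Tendsto (fun X : ℝ => ∫ y in (-π)..π, FF α ξ t ((-X : ℝ) + y * Complex.I))
      Filter.atTop (nhds 0) := by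
  have e0 : Filter.Tendsto (fun X : ℝ => Real.exp (-X)) Filter.atTop (nhds 0) :=
    Real.tendsto_exp_neg_atTop_nhds_zero
  have e1 : Filter.Tendsto (fun X : ℝ => Real.exp (-X * α)) Filter.atTop (nhds 0) := by
    apply Real.tendsto_exp_atBot.comp
    exact Filter.tendsto_neg_atTop_atBot.atBot_mul_const hα.1
  apply squeeze_zero_norm' (a := fun X : ℝ => Real.exp (-X) * (Real.exp t / (ξ / 2)) * |π - -π|)
  · filter_upwards [e1.eventually_le_const (half_pos hξ), Filter.eventually_ge_atTop 0] with X h1 h2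
    apply intervalIntegral.norm_integral_le_of_norm_le_const
    intro y _
    exact FF_bound_left ht hξ y (by linarith) h1
  · simpa using (e0.mul_const (Real.exp t / (ξ / 2))).mul_const |π - -π|

lemma lim_right {α ξ φ t : ℝ} (hα : α ∈ Ioo (0:ℝ) 2) (hξ : 0 < ξ) (ht : 0 < t)
    (hc : Real.cos φ < 0) (a b : ℝ) (hab : ∀ y ∈ uIoc a b, Real.cos y ≤ Real.cos φ) :
    Filter.Tendsto (fun X : ℝ => ∫ y in a..b, FF α ξ t (X + y * Complex.I))
      Filter.atTop (nhds 0) := by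
  have e0 := (tendsto_rpow_mul_exp_neg_mul_atTop_nhds_zero 1 (-(t * Real.cos φ))
    (by nlinarith)).comp Real.tendsto_exp_atTop
  have e1 := ((tendsto_rpow_atTop hα.1).comp Real.tendsto_exp_atTop).eventually_ge_atTop (ξ + 1)
  apply squeeze_zero_norm' (a := fun X : ℝ =>
    Real.exp X * Real.exp (t * Real.cos φ * Real.exp X) * |b - a|)
  · filter_upwards [e1] with X h1
    apply intervalIntegral.norm_integral_le_of_norm_le_const
    intro y hy
    rw [FF_eq_gg, norm_mul, Complex.norm_real, Real.norm_of_nonneg (Real.exp_nonneg _)]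
    gcongr
    refine (gg_bound hξ h1).trans ?_
    gcongr
    exact hab y hy
  · simpa [Function.comp_def] using e0.mul_const |b - a|

lemma lim_gg {g : ℝ → ℂ} (hg : IntegrableOn g (Ioi 0)) :
    Filter.Tendsto (fun X : ℝ => ∫ τ in (Real.exp (-X))..(Real.exp X), g τ)
      Filter.atTop (nhds (∫ τ in Ioi 0, g τ)) := by
  have h1 := intervalIntegral_tendsto_integral_Ioi 0 hg Real.tendsto_exp_atTop
  have hi : ∀ b : ℝ, 0 ≤ b → IntervalIntegrable g volume 0 b := fun b hb => by
    rw [intervalIntegrable_iff_integrableOn_Ioc_of_le hb]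
    exact hg.mono_set Ioc_subset_Ioi_self
  have h2 : Filter.Tendsto (fun X : ℝ => ∫ τ in (0:ℝ)..(Real.exp (-X)), g τ)
      Filter.atTop (nhds 0) := by
    have hc := intervalIntegral.continuousOn_primitive_interval' (hi 1 zero_le_one)
      (left_mem_uIcc)
    have := hc 0 left_mem_uIcc
    have h3 : Filter.Tendsto (fun X : ℝ => Real.exp (-X)) Filter.atTop
        (nhdsWithin 0 (uIcc 0 1)) := by
      refine tendsto_nhdsWithin_iff.mpr ⟨Real.tendsto_exp_neg_atTop_nhds_zero, ?_⟩
      filter_upwards [Filter.eventually_ge_atTop 0] with X hX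
      rw [uIcc_of_le zero_le_one]
      exact ⟨(Real.exp_pos _).le, Real.exp_le_one_iff.mpr (by linarith)⟩
    have h4 := Filter.Tendsto.comp this h3
    simpa [Function.comp_def] using h4
  have h5 := h1.sub h2
  rw [sub_zero] at h5
  refine h5.congr (fun X => ?_)
  exact intervalIntegral.integral_interval_sub_left (hi _ (Real.exp_pos _).le)
    (hi _ (Real.exp_pos _).le)

lemma G_ray {α ξ t θ τ : ℝ} (hτ : 0 < τ) (h1 : -π < θ) (h2 : θ ≤ π) :
    Complex.exp (Complex.I * θ) •
      (fun l : ℂ => Complex.exp (l * (t : ℂ)) / (l ^ (α : ℂ) - (ξ : ℂ)))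
        ((τ : ℂ) * Complex.exp (Complex.I * θ)) = gg α ξ t θ τ := by
  have hne : (τ : ℂ) * Complex.exp (Complex.I * θ) ≠ 0 :=
    mul_ne_zero (by exact_mod_cast hτ.ne') (Complex.exp_ne_zero _)
  have hlog : Complex.log ((τ : ℂ) * Complex.exp (Complex.I * θ))
      = Real.log τ + Complex.I * θ := by
    rw [Complex.log_ofReal_mul hτ (Complex.exp_ne_zero _), Complex.log_exp]
    · simpa using h1
    · simpa using h2
  unfold gg
  simp only [smul_eq_mul]
  congr 3
  rw [Complex.cpow_def_of_ne_zero hne, hlog, Real.rpow_def_of_pos hτ, Complex.ofReal_exp,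
    ← Complex.exp_add]
  congr 1
  push_cast; ring

lemma gg_pi {α ξ t τ : ℝ} (hα : α ∈ Ioo (0:ℝ) 2) (hξ : 0 < ξ) (hτ : 0 < τ) :
    gg α ξ t π τ - gg α ξ t (-π) τ = 2 * Complex.I *
      ((Real.exp (-(t * τ)) * τ ^ α * Real.sin (α * π) /
            (τ ^ (2 * α) - 2 * ξ * Real.cos (α * π) * τ ^ α + ξ ^ 2) : ℝ) : ℂ) := by
  have hpi := Real.pi_pos
  have n1 := nonvanish hα hξ (θ := π) hpi.ne' (abs_of_pos hpi).le (Real.rpow_nonneg hτ.le α)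
  have n2 := nonvanish hα hξ (θ := -π) (by linarith) (by rw [abs_neg, abs_of_pos hpi])
    (Real.rpow_nonneg hτ.le α)
  have hpow : τ ^ (2 * α) = (τ ^ α) ^ 2 := by
    rw [mul_comm, Real.rpow_mul hτ.le]; norm_cast
  have a1 : Complex.exp (Complex.I * π) = -1 := by rw [mul_comm, Complex.exp_pi_mul_I]
  have a2 : Complex.exp (Complex.I * ((-π : ℝ) : ℂ)) = -1 := by
    rw [show Complex.I * ((-π : ℝ) : ℂ) = -(Complex.I * π) by push_cast; ring, Complex.exp_neg, a1]
    norm_num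
  have a3 : Complex.exp (Complex.I * π * α)
      = (Real.cos (α * π) : ℂ) + (Real.sin (α * π) : ℂ) * Complex.I := by
    rw [show Complex.I * π * α = ((α * π : ℝ) : ℂ) * Complex.I by push_cast; ring,
      Complex.exp_mul_I, Complex.ofReal_cos, Complex.ofReal_sin]
  have a4 : Complex.exp (Complex.I * ((-π : ℝ) : ℂ) * α)
      = (Real.cos (α * π) : ℂ) - (Real.sin (α * π) : ℂ) * Complex.I := by
    rw [show Complex.I * ((-π : ℝ) : ℂ) * α = ((-(α * π) : ℝ) : ℂ) * Complex.I by push_cast; ring,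
      Complex.exp_mul_I, ← Complex.ofReal_cos, ← Complex.ofReal_sin, Real.cos_neg, Real.sin_neg]
    push_cast; ring
  have hcs : (Real.cos (α * π) : ℂ) ^ 2 + (Real.sin (α * π) : ℂ) ^ 2 = 1 := by
    exact_mod_cast Real.cos_sq_add_sin_sq (α * π)
  rw [a3] at n1
  rw [a4] at n2
  unfold gg
  rw [a1, a2, a3, a4, hpow]
  have e : Complex.exp ((τ : ℂ) * -1 * t) = (Real.exp (-(t * τ)) : ℂ) := by
    rw [Complex.ofReal_exp]; congr 1; push_cast; ring
  rw [e]
  have hI := Complex.I_sq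
  generalize Real.exp (-(t * τ)) = E at *
  generalize Real.cos (α * π) = c at *
  generalize Real.sin (α * π) = s at *
  generalize τ ^ α = p at *
  have hden : ((p ^ 2 - 2 * ξ * c * p + ξ ^ 2 : ℝ) : ℂ)
      = ((p : ℂ) * (c + s * Complex.I) - ξ) * ((p : ℂ) * (c - s * Complex.I) - ξ) := by
    push_cast
    linear_combination (-(p : ℂ) ^ 2) * hcs + (p : ℂ) ^ 2 * s ^ 2 * hI
  rw [Complex.ofReal_div, hden]
  field_simp
  push_cast
  ring

/-- For `α ∈ (0,2)`, `π/2 < φ < π` with `αφ < π`, `r, ξ > 0` with `r^α < ξ` and `t > 0`,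
`(1/(2πi)) ∫_{Γ(φ,r)} e^{λt}/(λ^α − ξ) dλ
  = (1/π) ∫₀^∞ e^{−tτ} τ^α sin(απ) / (τ^{2α} − 2ξ cos(απ) τ^α + ξ²) dτ`. -/
theorem contour_integral_real_representation
    (α : ℝ) (hα : α ∈ Ioo (0:ℝ) 2)
    (φ : ℝ) (hφ₁ : π / 2 < φ) (hφ₂ : φ < π) (hφ₃ : α * φ < π)
    (r ξ : ℝ) (hr : 0 < r) (hξ : 0 < ξ) (hrξ : r ^ α < ξ)
    (t : ℝ) (ht : 0 < t) :
    (2 * π * Complex.I)⁻¹ *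
        contourIntegral φ r (fun l => Complex.exp (l * (t : ℂ)) / (l ^ (α : ℂ) - (ξ : ℂ)))
      = ((π⁻¹ * ∫ τ in Ioi (0:ℝ),
          Real.exp (-(t * τ)) * τ ^ α * Real.sin (α * π) /
            (τ ^ (2 * α) - 2 * ξ * Real.cos (α * π) * τ ^ α + ξ ^ 2) : ℝ) : ℂ) := by
  have hpi := Real.pi_pos
  have hcφ : Real.cos φ < 0 := Real.cos_neg_of_pi_div_two_lt_of_lt hφ₁ (by linarith)
  have q1 : |φ| ≤ π := abs_le.mpr ⟨by linarith, by linarith⟩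
  have i1 := gg_integrable ht hα hξ hcφ q1
  have i2 := gg_integrable (θ := -φ) ht hα hξ (by rwa [Real.cos_neg]) (by rwa [abs_neg])
  have i3 := gg_integrable (θ := π) ht hα hξ (by simp) (abs_of_pos hpi).le
  have i4 := gg_integrable (θ := -π) ht hα hξ (by simp) (by rw [abs_neg, abs_of_pos hpi])
  have hsub : Ioi r ⊆ Ioi 0 := Ioi_subset_Ioi hr.le
  have L1 := intervalIntegral_tendsto_integral_Ioi r (i1.mono_set hsub) Real.tendsto_exp_atTop
  have L2 := intervalIntegral_tendsto_integral_Ioi r (i2.mono_set hsub) Real.tendsto_exp_atTop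
  have L3 := lim_gg i3
  have L4 := lim_gg i4
  have L5 := lim_left hα hξ ht
  have L6 := lim_right hα hξ ht hcφ φ π (by
    intro y hy
    rw [uIoc_of_le hφ₂.le] at hy
    exact Real.cos_le_cos_of_nonneg_of_le_pi (by linarith) hy.2 hy.1.le)
  have L7 := lim_right hα hξ ht hcφ (-π) (-φ) (by
    intro y hy
    rw [uIoc_of_le (by linarith)] at hy
    rw [← Real.cos_neg y]
    exact Real.cos_le_cos_of_nonneg_of_le_pi (by linarith) (by linarith [hy.1]) (by linarith [hy.2]))
  have LL := (L1.sub L2).add_const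
    (Complex.I * (∫ y in (-φ)..φ, FF α ξ t (Real.log r + y * Complex.I)))
  have RR := (((L3.sub L4).add (L5.const_mul Complex.I)).sub (L6.const_mul Complex.I)).sub
    (L7.const_mul Complex.I)
  have main := tendsto_nhds_unique_of_eventuallyEq LL RR (by
    filter_upwards [Filter.eventually_ge_atTop (Real.log r),
      Filter.eventually_ge_atTop (-Real.log r)] with X h1 h2
    exact key hα hφ₁ hφ₂ hr hξ hrξ h1 (by linarith))
  simp only [mul_zero, add_zero, sub_zero] at main
  rw [← integral_sub (i1.mono_set hsub) (i2.mono_set hsub), ← integral_sub i3 i4] at main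
  have hC : contourIntegral φ r
      (fun l => Complex.exp (l * (t : ℂ)) / (l ^ (α : ℂ) - (ξ : ℂ)))
      = (∫ τ in Ioi r, (gg α ξ t φ τ - gg α ξ t (-φ) τ))
        + Complex.I * (∫ y in (-φ)..φ, FF α ξ t (Real.log r + y * Complex.I)) := by
    unfold contourIntegral
    congr 1
    · apply setIntegral_congr_fun measurableSet_Ioi
      intro τ hτ
      have hτ0 : 0 < τ := hr.trans hτ
      have g1 := G_ray (α := α) (ξ := ξ) (t := t) (θ := φ) hτ0 (by linarith) hφ₂.le
      have g2 := G_ray (α := α) (ξ := ξ) (t := t) (θ := -φ) hτ0 (by linarith) (by linarith)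
      rw [show Complex.I * ((-φ : ℝ) : ℂ) = -(Complex.I * φ) by push_cast; ring] at g2
      simp only at g1 g2 ⊢
      rw [g1, g2]
    · rw [← intervalIntegral.integral_const_mul]
      apply intervalIntegral.integral_congr
      intro y hy
      rw [uIcc_of_le (by linarith)] at hy
      have g1 := G_ray (α := α) (ξ := ξ) (t := t) (θ := y) hr (by linarith [hy.1])
        (by linarith [hy.2])
      simp only [smul_eq_mul] at g1 ⊢
      rw [FF_eq_gg, Real.exp_log hr, ← g1]
      ring
  rw [hC, main]
  have hR : (∫ τ in Ioi (0:ℝ), (gg α ξ t π τ - gg α ξ t (-π) τ))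
      = 2 * Complex.I * ((∫ τ in Ioi (0:ℝ), Real.exp (-(t * τ)) * τ ^ α * Real.sin (α * π) /
            (τ ^ (2 * α) - 2 * ξ * Real.cos (α * π) * τ ^ α + ξ ^ 2) : ℝ) : ℂ) := by
    rw [← integral_complex_ofReal, ← integral_const_mul]
    apply setIntegral_congr_fun measurableSet_Ioi
    intro τ hτ
    exact gg_pi hα hξ hτ
  rw [hR]
  have hp : (π : ℂ) ≠ 0 := by exact_mod_cast hpi.ne'
  have hI := Complex.I_ne_zero
  rw [Complex.ofReal_mul, Complex.ofReal_inv]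
  generalize (∫ τ in Ioi (0:ℝ), Real.exp (-(t * τ)) * τ ^ α * Real.sin (α * π) /
            (τ ^ (2 * α) - 2 * ξ * Real.cos (α * π) * τ ^ α + ξ ^ 2)) = J
  field_simp
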